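/- (Doubling orbit classification) Let W be a nondegenerate ε-hermitian space over a field E with involution, char ≠ 2, 2W = W ⊕ (-W), and let Ω(2W) be the set of maximal totally isotropic subspaces of 2W. Two elements Z, Z' ∈ Ω(2W) lie in the same orbit of U(W) × U(-W) (acting componentwise) if and only if dim(Z ∩ (W ⊕ 0)) = dim(Z' ∩ (W ⊕ 0)). -/

import Mathlib

section DoublingHelpers

structure EHForm {E V : Type*} [Field E] [AddCommGroup V] [Module E V]
    (σ : E →+* E) (ε : E) (φ : V → V → E) : Prop where
  inv : ∀ a, σ (σ a) = a
  sgn : ε = 1 ∨ ε = -1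
  addl : ∀ w w' v, φ (w + w') v = φ w v + φ w' v
  addr : ∀ w v v', φ w (v + v') = φ w v + φ w v'
  smull : ∀ (a : E) w v, φ (a • w) v = a * φ w v
  smulr : ∀ (a : E) w v, φ w (a • v) = σ a * φ w v
  herm : ∀ w v, φ v w = ε * σ (φ w v)
  nd : ∀ w, (∀ v, φ w v = 0) → w = 0

namespace EHForm

variable {E V : Type*} [Field E] [AddCommGroup V] [Module E V]
  {σ : E →+* E} {ε : E} {φ : V → V → E}

def lin (h : EHForm σ ε φ) (v : V) : V →ₗ[E] E where
  toFun w := φ w v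
  map_add' _ _ := h.addl _ _ _
  map_smul' _ _ := h.smull _ _ _

theorem lin_apply (h : EHForm σ ε φ) (v w : V) : h.lin v w = φ w v := rfl

theorem swap0 (h : EHForm σ ε φ) {v w : V} (hh : φ v w = 0) : φ w v = 0 := by
  rw [h.herm v w, hh]; simp

theorem zl (h : EHForm σ ε φ) (v : V) : φ 0 v = 0 := (h.lin v).map_zero
theorem zr (h : EHForm σ ε φ) (v : V) : φ v 0 = 0 := h.swap0 (h.zl v)
theorem subl (h : EHForm σ ε φ) (u w v : V) : φ (u - w) v = φ u v - φ w v :=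
  (h.lin v).map_sub u w

def perp (h : EHForm σ ε φ) (U : Submodule E V) : Submodule E V where
  carrier := {w | ∀ u ∈ U, φ u w = 0}
  add_mem' ha hb u hu := by rw [h.addr, ha u hu, hb u hu, add_zero]
  zero_mem' u _ := h.zr u
  smul_mem' a x hx u hu := by rw [h.smulr, hx u hu, mul_zero]

theorem mem_perp (h : EHForm σ ε φ) {U : Submodule E V} {w : V} :
    w ∈ h.perp U ↔ ∀ u ∈ U, φ u w = 0 := Iff.rfl

theorem mem_perp' (h : EHForm σ ε φ) {U : Submodule E V} {w : V} :
    w ∈ h.perp U ↔ ∀ u ∈ U, φ w u = 0 :=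
  ⟨fun hw u hu => h.swap0 (hw u hu), fun hw u hu => h.swap0 (hw u hu)⟩

/-- the range of `v ↦ φ(·, v)` -/
def ran (h : EHForm σ ε φ) : Submodule E (Module.Dual E V) where
  carrier := {f | ∃ v, f = h.lin v}
  add_mem' := by
    rintro _ _ ⟨v, rfl⟩ ⟨w, rfl⟩
    exact ⟨v + w, by ext x; simp [lin_apply, h.addr]⟩
  zero_mem' := ⟨0, by ext x; simp [lin_apply, h.zr]⟩
  smul_mem' := by
    rintro a _ ⟨v, rfl⟩
    exact ⟨σ a • v, by ext x; simp [lin_apply, h.smulr, h.inv]⟩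

theorem riesz [FiniteDimensional E V] (h : EHForm σ ε φ) (f : V →ₗ[E] E) :
    ∃ v, ∀ w, φ w v = f w := by
  have hr : h.ran.dualCoannihilator = ⊥ := by
    rw [eq_bot_iff]
    intro w hw
    rw [Submodule.mem_dualCoannihilator] at hw
    exact h.nd w fun v => hw (h.lin v) ⟨v, rfl⟩
  have h1 := Subspace.dualCoannihilator_dualAnnihilator_eq (W := h.ran)
  rw [hr, Submodule.dualAnnihilator_bot] at h1
  have : f ∈ h.ran := h1 ▸ Submodule.mem_top
  obtain ⟨v, hv⟩ := this
  exact ⟨v, fun w => by rw [hv]; rfl⟩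

theorem sep [FiniteDimensional E V] (h : EHForm σ ε φ) {U : Submodule E V} {x : V}
    (hx : x ∉ U) : ∃ w ∈ h.perp U, φ x w ≠ 0 := by
  obtain ⟨f, hf, hU⟩ := Submodule.exists_le_ker_of_notMem hx
  obtain ⟨w, hw⟩ := h.riesz f
  exact ⟨w, fun u hu => by rw [hw]; exact hU hu, by rwa [hw]⟩

theorem perp_perp [FiniteDimensional E V] (h : EHForm σ ε φ) (U : Submodule E V) :
    h.perp (h.perp U) = U := by
  apply le_antisymm
  · intro x hx
    by_contra hn
    obtain ⟨w, hw, hne⟩ := h.sep hn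
    exact hne (h.swap0 (hx w hw))
  · intro x hx u hu
    exact h.swap0 (hu x hx)

theorem finrank_perp [FiniteDimensional E V] (h : EHForm σ ε φ) (U : Submodule E V) :
    Module.finrank E U + Module.finrank E (h.perp U) = Module.finrank E V := by
  have key : Module.finrank E (h.perp U) = Module.finrank E U.dualAnnihilator := by
    let j : h.perp U →+ U.dualAnnihilator :=
      { toFun := fun v => ⟨h.lin v, by
          rw [Submodule.mem_dualAnnihilator]; exact fun w hw => v.2 w hw⟩
        map_zero' := by ext x; simp [lin_apply, h.zr]
        map_add' := fun v w => by ext x; simp [lin_apply, h.addr] }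
    have hj : Function.Bijective j := by
      constructor
      · rw [injective_iff_map_eq_zero]
        intro v hv
        have : ∀ w, φ w v = 0 := fun w =>
          congrArg (fun t : U.dualAnnihilator => (t : Module.Dual E V) w) hv
        exact Subtype.ext (h.nd _ fun w => h.swap0 (this w))
      · rintro ⟨f, hf⟩
        obtain ⟨v, hv⟩ := h.riesz f
        rw [Submodule.mem_dualAnnihilator] at hf
        refine ⟨⟨v, fun u hu => by rw [hv, hf u hu]⟩, ?_⟩
        ext w
        exact hv w
    have hb : Function.Bijective σ := Function.Involutive.bijective h.inv
    let e : h.perp U ≃+ U.dualAnnihilator := AddEquiv.ofBijective j hj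
    have he : ∀ (r : E) (m : h.perp U), e (r • m) = σ r • e m := by
      intro r m
      ext w
      exact h.smulr r w m
    have := congrArg Cardinal.toNat (lift_rank_eq_of_equiv_equiv (σ : E → E) e hb he)
    simp only [Cardinal.toNat_lift] at this
    exact this
  rw [key, Subspace.finrank_add_finrank_dualAnnihilator_eq]

/-- totally isotropic -/
def Iso (φ : V → V → E) (Z : Submodule E V) : Prop := ∀ x ∈ Z, ∀ y ∈ Z, φ x y = 0

theorem iso_sup (h : EHForm σ ε φ) {A B : Submodule E V} (hA : Iso φ A) (hB : Iso φ B)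
    (hAB : ∀ a ∈ A, ∀ b ∈ B, φ a b = 0) : Iso φ (A ⊔ B) := by
  intro x hx y hy
  obtain ⟨a, ha, b, hb, rfl⟩ := Submodule.mem_sup.1 hx
  obtain ⟨c, hc, d, hd, rfl⟩ := Submodule.mem_sup.1 hy
  rw [h.addl, h.addr, h.addr, hA a ha c hc, hB b hb d hd, hAB a ha d hd,
    h.swap0 (hAB c hc b hb)]
  simp

theorem lagr [FiniteDimensional E V] (h : EHForm σ ε φ) {L Z : Submodule E V}
    (hL : h.perp L = L) (hZ : Iso φ Z) (hmax : ∀ Z₁, Iso φ Z₁ → Z ≤ Z₁ → Z₁ = Z) :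
    h.perp Z ≤ Z := by
  have h1 : Iso φ ((L ⊓ h.perp Z) ⊔ Z) := by
    refine h.iso_sup ?_ hZ ?_
    · intro x hx y hy
      have := hL.symm ▸ hy.1
      exact this x hx.1
    · intro a ha b hb
      exact h.swap0 (ha.2 b hb)
  have h2 := hmax _ h1 le_sup_right
  have h3 : L ⊓ h.perp Z ≤ Z := le_sup_left.trans h2.le
  have h4 : h.perp (L ⊔ Z) ≤ L ⊓ h.perp Z := by
    intro x hx
    refine ⟨?_, fun u hu => hx u (Submodule.mem_sup_right hu)⟩
    have : x ∈ h.perp L := fun u hu => hx u (Submodule.mem_sup_left hu)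
    rwa [hL] at this
  intro x hx
  have hx2 : x ∈ L ⊔ Z := by
    rw [← h.perp_perp (L ⊔ Z)]
    intro u hu
    exact hx u (h3 (h4 hu))
  obtain ⟨l, hl, z, hz, rfl⟩ := Submodule.mem_sup.1 hx2
  refine Z.add_mem (h3 ⟨hl, ?_⟩) hz
  have : z ∈ h.perp Z := fun u hu => hZ u hu z hz
  have := (h.perp Z).sub_mem hx this
  simpa using this

theorem exists_max [FiniteDimensional E V] (P : Submodule E V → Prop) {G : Submodule E V}
    (hG : P G) : ∃ Z, G ≤ Z ∧ P Z ∧ ∀ Z₁, P Z₁ → Z ≤ Z₁ → Z₁ = Z := by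
  obtain ⟨Z, ⟨h1, h2⟩, h3⟩ := (wellFounded_gt (α := Submodule E V)).has_min
    {Z | G ≤ Z ∧ P Z} ⟨G, le_rfl, hG⟩
  refine ⟨Z, h1, h2, fun Z₁ hZ₁ hle => ?_⟩
  by_contra hne
  exact h3 Z₁ ⟨h1.trans hle, hZ₁⟩ (lt_of_le_of_ne hle (Ne.symm hne))

/-- the doubled form -/
def dbl (φ : V → V → E) : V × V → V × V → E := fun p q => φ p.1 q.1 - φ p.2 q.2

theorem double (h : EHForm σ ε φ) : EHForm σ ε (dbl φ) where
  inv := h.inv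
  sgn := h.sgn
  addl _ _ _ := by simp only [dbl, Prod.fst_add, Prod.snd_add, h.addl]; ring
  addr _ _ _ := by simp only [dbl, Prod.fst_add, Prod.snd_add, h.addr]; ring
  smull _ _ _ := by simp only [dbl, Prod.smul_fst, Prod.smul_snd, h.smull]; ring
  smulr _ _ _ := by simp only [dbl, Prod.smul_fst, Prod.smul_snd, h.smulr]; ring
  herm w v := by
    simp only [dbl, map_sub]
    rw [h.herm w.1 v.1, h.herm w.2 v.2]; ring
  nd w hw := by
    refine Prod.ext (h.nd _ fun v => ?_) (h.nd _ fun v => ?_)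
    · simpa [dbl, h.zr] using hw (v, 0)
    · simpa [dbl, h.zr] using hw (0, v)

theorem lagr_double [FiniteDimensional E V] (h : EHForm σ ε φ) {Z : Submodule E (V × V)}
    (hZ : Iso (dbl φ) Z) (hmax : ∀ Z₁, Iso (dbl φ) Z₁ → Z ≤ Z₁ → Z₁ = Z) :
    h.double.perp Z ≤ Z := by
  refine h.double.lagr (L := LinearMap.range (LinearMap.prod LinearMap.id LinearMap.id)) ?_ hZ hmax
  ext ⟨x, y⟩
  constructor
  · intro hx
    refine ⟨x, ?_⟩
    have : x - y = 0 := h.nd _ fun v => by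
      have := hx (v, v) ⟨v, rfl⟩
      have h1 := h.double.swap0 this
      rw [h.subl]
      exact h1
    rw [sub_eq_zero] at this
    simp [this]
  · rintro ⟨w, hw⟩
    simp at hw
    obtain ⟨rfl, rfl⟩ := hw
    rintro _ ⟨u, rfl⟩
    simp [dbl]

theorem step [FiniteDimensional E V] (h : EHForm σ ε φ) (h2 : (2 : E) ≠ 0)
    {G : Submodule E (V × V)} (hG : Iso (dbl φ) G)
    (hl : ∀ w, (w, (0 : V)) ∈ G → w = 0) (hr : ∀ w, ((0 : V), w) ∈ G → w = 0)
    (htop : G.map (LinearMap.fst E V V) ≠ ⊤) :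
    ∃ u v : V, (∀ p ∈ G, dbl φ p (u, v) = 0) ∧ φ u u = φ v v ∧
      (∀ p ∈ G, p.1 ≠ u) ∧ (∀ p ∈ G, p.2 ≠ v) := by
  have hinj1 : Function.Injective ((LinearMap.fst E V V).comp G.subtype) := by
    rw [injective_iff_map_eq_zero]
    rintro ⟨⟨a, b⟩, hab⟩ h0
    obtain rfl : a = 0 := h0
    obtain rfl := hr b hab
    rfl
  have hinj2 : Function.Injective ((LinearMap.snd E V V).comp G.subtype) := by
    rw [injective_iff_map_eq_zero]
    rintro ⟨⟨a, b⟩, hab⟩ h0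
    obtain rfl : b = 0 := h0
    obtain rfl := hl a hab
    rfl
  have hiso : ∀ p ∈ G, ∀ q ∈ G, φ p.1 q.1 = φ p.2 q.2 := fun p hp q hq =>
    sub_eq_zero.1 (hG p hp q hq)
  by_cases hrad : ∃ r ∈ G, r.1 ≠ 0 ∧ ∀ p ∈ G, φ p.1 r.1 = 0
  · obtain ⟨⟨r, r'⟩, hrG, hr0, hrp⟩ := hrad
    simp only at hr0 hrp
    have hrp' : ∀ p ∈ G, φ p.2 r' = 0 := fun p hp => by
      rw [← hrp p hp]; exact (hiso p hp _ hrG).symm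
    obtain ⟨u, hu⟩ : ∃ u, φ u r = 1 := by
      by_contra hn
      push Not at hn
      refine hr0 (h.nd r fun v => h.swap0 ?_)
      by_contra hne
      exact hn ((φ v r)⁻¹ • v) (by rw [h.smull, inv_mul_cancel₀ hne])
    obtain ⟨k, hk⟩ := LinearMap.exists_leftInverse_of_injective _ (LinearMap.ker_eq_bot.2 hinj2)
    obtain ⟨v0, hv0⟩ := h.riesz (((h.lin u).comp ((LinearMap.fst E V V).comp G.subtype)).comp k)
    have hv0' : ∀ p ∈ G, φ p.2 v0 = φ p.1 u := by
      intro p hp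
      rw [hv0]
      have := LinearMap.congr_fun hk ⟨p, hp⟩
      simp only [LinearMap.comp_apply, LinearMap.id_apply, Submodule.subtype_apply,
        LinearMap.snd_apply] at this
      simp only [LinearMap.comp_apply]
      rw [this]
      rfl
    have hru : φ r u = ε := by rw [h.herm u r, hu]; simp
    have hr'v0 : φ r' v0 = ε := by rw [← hru]; exact hv0' _ hrG
    have hσε : σ ε = ε := by rcases h.sgn with rfl | rfl <;> simp
    have hεε : ε * ε = 1 := by rcases h.sgn with rfl | rfl <;> simp
    have hv0r' : φ v0 r' = 1 := by rw [h.herm r' v0, hr'v0, hσε, hεε]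
    have hr'r' : φ r' r' = 0 := hrp' _ hrG
    set d := φ u u - φ v0 v0 with hd
    have hσd : σ d = ε * d := by
      have e1 := h.herm u u
      have e2 := h.herm v0 v0
      have : d = ε * σ d := by rw [hd, map_sub, mul_sub, ← e1, ← e2]
      rw [this, ← mul_assoc, hεε, one_mul, ← this]
    refine ⟨u, v0 + (ε * d / 2) • r', ?_, ?_, ?_, ?_⟩
    · intro p hp
      simp only [dbl]
      rw [h.addr, h.smulr, hrp' p hp, hv0' p hp]; simp
    · have hs : σ (ε * d / 2) = d / 2 := by
        rw [map_div₀, map_mul, hσd, hσε, ← mul_assoc, hεε, map_ofNat, one_mul]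
      rw [h.addl, h.addr, h.addr, h.smull, h.smull, h.smulr, h.smulr, hs, hv0r', hr'v0, hr'r']
      have : φ u u = φ v0 v0 + d := by rw [hd]; ring
      rw [this]
      have : ε * d / 2 * ε = d / 2 := by
        rw [show ε * d / 2 * ε = (ε * ε) * d / 2 by ring, hεε, one_mul]
      rw [this]
      field_simp
      ring
    · intro p hp he
      have := hrp p hp
      rw [he, hu] at this
      exact one_ne_zero this
    · intro p hp he
      have := hrp' p hp
      rw [he, h.addl, h.smull, hr'r', hv0r'] at this
      simp at this
  · push Not at hrad
    have hrad' : ∀ r ∈ G, (∀ p ∈ G, φ p.1 r.1 = 0) → r.1 = 0 := by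
      intro r hrG hp
      by_contra hne
      obtain ⟨p, hpG, hp0⟩ := hrad r hrG hne
      exact hp0 (hp p hpG)
    obtain ⟨Z, hGZ, hZ, hmax⟩ := exists_max (Iso (dbl φ)) hG
    have hZZ := h.lagr_double hZ hmax
    by_contra hcon
    push Not at hcon
    have hcon' : ∀ x ∈ Z, x.1 ∉ G.map (LinearMap.fst E V V) →
        x.2 ∈ G.map (LinearMap.snd E V V) := by
      intro x hx hx1
      obtain ⟨p, hp, hpe⟩ := hcon x.1 x.2 (fun p hp => hZ p (hGZ hp) x hx)
        (sub_eq_zero.1 (hZ x hx x hx)) (fun p hp he => hx1 ⟨p, hp, he⟩)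
      exact ⟨p, hp, hpe⟩
    have htop2 : G.map (LinearMap.snd E V V) ≠ ⊤ := by
      intro ht
      apply htop
      apply Submodule.eq_top_of_finrank_eq
      have e1 := LinearMap.finrank_range_of_inj hinj1
      have e2 := LinearMap.finrank_range_of_inj hinj2
      rw [LinearMap.range_comp, Submodule.range_subtype] at e1 e2
      rw [e1, ← e2, ht, finrank_top]
    have hex : ∀ U : Submodule E V, U ≠ ⊤ → ∃ w, w ≠ 0 ∧ w ∈ h.perp U := by
      intro U hU
      obtain ⟨x, hx⟩ : ∃ x, x ∉ U := by
        by_contra hn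
        push Not at hn
        exact hU (Submodule.eq_top_iff'.2 hn)
      obtain ⟨w, hw, hne⟩ := h.sep hx
      refine ⟨w, ?_, hw⟩
      rintro rfl
      exact hne (h.zr x)
    by_cases hc1 : ∀ x ∈ Z, x.1 ∈ G.map (LinearMap.fst E V V)
    · obtain ⟨w, hw0, hw⟩ := hex _ htop
      have hwZ : (w, (0 : V)) ∈ Z := hZZ fun p hp => by
        simp only [dbl]
        rw [hw _ (hc1 p hp), h.zr, sub_zero]
      obtain ⟨p, hp, hpe⟩ := hc1 _ hwZ
      apply hw0
      have hpe : p.1 = w := hpe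
      rw [← hpe]
      refine hrad' p hp fun q hq => ?_
      rw [hpe]
      exact hw _ ⟨q, hq, rfl⟩
    by_cases hc2 : ∀ x ∈ Z, x.2 ∈ G.map (LinearMap.snd E V V)
    · obtain ⟨w, hw0, hw⟩ := hex _ htop2
      have hwZ : ((0 : V), w) ∈ Z := hZZ fun p hp => by
        simp only [dbl]
        rw [hw _ (hc2 p hp), h.zr, sub_zero]
      obtain ⟨⟨p, p'⟩, hp, hpe⟩ := hc2 _ hwZ
      apply hw0
      obtain rfl : p' = w := hpe
      have : p = 0 := hrad' (p, p') hp fun q hq => by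
        rw [hiso q hq _ hp]
        exact hw _ ⟨q, hq, rfl⟩
      subst this
      exact hr _ hp
    · push Not at hc1 hc2
      obtain ⟨x, hx, hx1⟩ := hc1
      obtain ⟨y, hy, hy2⟩ := hc2
      have hx2 := hcon' x hx hx1
      have hy1 : y.1 ∈ G.map (LinearMap.fst E V V) := by
        by_contra hn
        exact hy2 (hcon' y hy hn)
      have := hcon' (x + y) (Z.add_mem hx hy) (fun hm => hx1 (by
        have := Submodule.sub_mem _ hm hy1
        simpa using this))
      apply hy2
      have := Submodule.sub_mem _ this hx2
      simpa using this

theorem witt [FiniteDimensional E V] (h : EHForm σ ε φ) (h2 : (2 : E) ≠ 0)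
    {G₀ : Submodule E (V × V)} (hG₀ : Iso (dbl φ) G₀)
    (hl₀ : ∀ w, (w, (0 : V)) ∈ G₀ → w = 0) (hr₀ : ∀ w, ((0 : V), w) ∈ G₀ → w = 0) :
    ∃ g : V ≃ₗ[E] V, (∀ u v, φ (g u) (g v) = φ u v) ∧ ∀ p ∈ G₀, g p.1 = p.2 := by
  obtain ⟨G, hle, ⟨hG, hl, hr⟩, hmax⟩ := exists_max
    (fun G : Submodule E (V × V) => Iso (dbl φ) G ∧ (∀ w, (w, (0 : V)) ∈ G → w = 0) ∧
      (∀ w, ((0 : V), w) ∈ G → w = 0)) ⟨hG₀, hl₀, hr₀⟩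
  have htop : G.map (LinearMap.fst E V V) = ⊤ := by
    by_contra htop
    obtain ⟨u, v, hp, huv, hu, hv⟩ := h.step h2 hG hl hr htop
    have hmem : (u, v) ∈ G := by
      rw [← hmax (G ⊔ Submodule.span E {(u, v)}) ⟨?_, ?_, ?_⟩ le_sup_left]
      · exact Submodule.mem_sup_right (Submodule.mem_span_singleton_self _)
      · refine h.double.iso_sup hG ?_ ?_
        · intro x hx y hy
          obtain ⟨a, rfl⟩ := Submodule.mem_span_singleton.1 hx
          obtain ⟨b, rfl⟩ := Submodule.mem_span_singleton.1 hy
          rw [h.double.smull, h.double.smulr]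
          simp [dbl, huv]
        · intro x hx y hy
          obtain ⟨b, rfl⟩ := Submodule.mem_span_singleton.1 hy
          rw [h.double.smulr, hp x hx, mul_zero]
      · intro w hw
        obtain ⟨x, hx, y, hy, he⟩ := Submodule.mem_sup.1 hw
        obtain ⟨b, rfl⟩ := Submodule.mem_span_singleton.1 hy
        by_cases hb : b = 0
        · subst hb
          rw [zero_smul, add_zero] at he
          exact hl w (he ▸ hx)
        · exfalso
          refine hv _ (G.smul_mem (-b⁻¹) hx) ?_
          have := congrArg Prod.snd he
          simp only [Prod.snd_add, Prod.smul_snd] at this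
          rw [Prod.smul_snd, eq_neg_of_add_eq_zero_left this]
          simp [smul_smul, hb]
      · intro w hw
        obtain ⟨x, hx, y, hy, he⟩ := Submodule.mem_sup.1 hw
        obtain ⟨b, rfl⟩ := Submodule.mem_span_singleton.1 hy
        by_cases hb : b = 0
        · subst hb
          rw [zero_smul, add_zero] at he
          exact hr w (he ▸ hx)
        · exfalso
          refine hu _ (G.smul_mem (-b⁻¹) hx) ?_
          have := congrArg Prod.fst he
          simp only [Prod.fst_add, Prod.smul_fst] at this
          rw [Prod.smul_fst, eq_neg_of_add_eq_zero_left this]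
          simp [smul_smul, hb]
    exact hu _ hmem rfl
  have hinj1 : Function.Injective ((LinearMap.fst E V V).comp G.subtype) := by
    rw [injective_iff_map_eq_zero]
    rintro ⟨⟨a, b⟩, hab⟩ h0
    obtain rfl : a = 0 := h0
    obtain rfl := hr b hab
    rfl
  have hinj2 : Function.Injective ((LinearMap.snd E V V).comp G.subtype) := by
    rw [injective_iff_map_eq_zero]
    rintro ⟨⟨a, b⟩, hab⟩ h0
    obtain rfl : b = 0 := h0
    obtain rfl := hl a hab
    rfl
  have hsur1 : Function.Surjective ((LinearMap.fst E V V).comp G.subtype) := by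
    rw [← LinearMap.range_eq_top, LinearMap.range_comp, Submodule.range_subtype, htop]
  let e1 := LinearEquiv.ofBijective _ ⟨hinj1, hsur1⟩
  have hsur2 : Function.Surjective ((LinearMap.snd E V V).comp G.subtype) :=
    (LinearMap.injective_iff_surjective_of_finrank_eq_finrank e1.finrank_eq).1 hinj2
  let e2 := LinearEquiv.ofBijective _ ⟨hinj2, hsur2⟩
  have key : ∀ p : G, (e1.symm.trans e2) p.1.1 = p.1.2 := by
    intro p
    have : e1.symm p.1.1 = p := e1.symm_apply_apply p
    rw [LinearEquiv.trans_apply, this]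
    rfl
  refine ⟨e1.symm.trans e2, ?_, fun p hp => key ⟨p, hle hp⟩⟩
  intro u v
  obtain ⟨p, rfl⟩ := hsur1 u
  obtain ⟨q, rfl⟩ := hsur1 v
  have e1 := key p
  have e2 := key q
  simp only [LinearMap.comp_apply, Submodule.subtype_apply, LinearMap.fst_apply]
  rw [e1, e2]
  exact (sub_eq_zero.1 (hG p p.2 q q.2)).symm
theorem map_fst_eq [FiniteDimensional E V] (h : EHForm σ ε φ) {Z : Submodule E (V × V)}
    (hZ : Iso (dbl φ) Z) (hZZ : h.double.perp Z ≤ Z) :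
    Z.map (LinearMap.fst E V V) = h.perp (Z.comap (LinearMap.inl E V V)) := by
  rw [← h.perp_perp (Z.map (LinearMap.fst E V V))]
  congr 1
  ext w
  constructor
  · intro hw
    refine hZZ fun p hp => ?_
    simp only [dbl, LinearMap.inl_apply]
    rw [hw p.1 ⟨p, hp, rfl⟩, h.zr, sub_zero]
  · rintro hw _ ⟨p, hp, rfl⟩
    have := hZ p hp _ hw
    simpa [dbl, h.zr] using this

theorem map_snd_eq [FiniteDimensional E V] (h : EHForm σ ε φ) {Z : Submodule E (V × V)}
    (hZ : Iso (dbl φ) Z) (hZZ : h.double.perp Z ≤ Z) :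
    Z.map (LinearMap.snd E V V) = h.perp (Z.comap (LinearMap.inr E V V)) := by
  rw [← h.perp_perp (Z.map (LinearMap.snd E V V))]
  congr 1
  ext w
  constructor
  · intro hw
    refine hZZ fun p hp => ?_
    simp only [dbl, LinearMap.inr_apply]
    rw [hw p.2 ⟨p, hp, rfl⟩, h.zr, sub_zero]
  · rintro hw _ ⟨p, hp, rfl⟩
    have := hZ p hp _ hw
    simpa [dbl, h.zr] using this

theorem rank_fst [FiniteDimensional E V] (Z : Submodule E (V × V)) :
    Module.finrank E (Z.map (LinearMap.fst E V V)) +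
      Module.finrank E (Z.comap (LinearMap.inr E V V)) = Module.finrank E Z := by
  rw [← LinearMap.finrank_range_add_finrank_ker ((LinearMap.fst E V V).comp Z.subtype),
    LinearMap.range_comp, Submodule.range_subtype]
  congr 1
  refine LinearEquiv.finrank_eq ?_
  exact
    { toFun := fun w => ⟨⟨(0, w.1), w.2⟩, rfl⟩
      invFun := fun p => ⟨p.1.1.2, by
        obtain ⟨⟨⟨a, b⟩, hab⟩, hp⟩ := p
        obtain rfl : a = 0 := hp
        exact hab⟩
      map_add' := fun a b => by ext <;> simp
      map_smul' := fun a b => by ext <;> simp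
      left_inv := fun a => rfl
      right_inv := fun p => by
        obtain ⟨⟨⟨a, b⟩, hab⟩, hp⟩ := p
        obtain rfl : a = 0 := hp
        rfl }

theorem rank_snd [FiniteDimensional E V] (Z : Submodule E (V × V)) :
    Module.finrank E (Z.map (LinearMap.snd E V V)) +
      Module.finrank E (Z.comap (LinearMap.inl E V V)) = Module.finrank E Z := by
  rw [← LinearMap.finrank_range_add_finrank_ker ((LinearMap.snd E V V).comp Z.subtype),
    LinearMap.range_comp, Submodule.range_subtype]
  congr 1
  refine LinearEquiv.finrank_eq ?_
  exact
    { toFun := fun w => ⟨⟨(w.1, 0), w.2⟩, rfl⟩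
      invFun := fun p => ⟨p.1.1.1, by
        obtain ⟨⟨⟨a, b⟩, hab⟩, hp⟩ := p
        obtain rfl : b = 0 := hp
        exact hab⟩
      map_add' := fun a b => by ext <;> simp
      map_smul' := fun a b => by ext <;> simp
      left_inv := fun a => rfl
      right_inv := fun p => by
        obtain ⟨⟨⟨a, b⟩, hab⟩, hp⟩ := p
        obtain rfl : b = 0 := hp
        rfl }

theorem rank_AB [FiniteDimensional E V] (h : EHForm σ ε φ) {Z : Submodule E (V × V)}
    (hZ : Iso (dbl φ) Z) (hZZ : h.double.perp Z ≤ Z) :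
    Module.finrank E (Z.comap (LinearMap.inr E V V)) =
      Module.finrank E (Z.comap (LinearMap.inl E V V)) := by
  have e1 := rank_fst Z
  have e2 := rank_snd Z
  rw [h.map_fst_eq hZ hZZ] at e1
  rw [h.map_snd_eq hZ hZZ] at e2
  have e3 := h.finrank_perp (Z.comap (LinearMap.inr E V V))
  have e4 := h.finrank_perp (Z.comap (LinearMap.inl E V V))
  omega

theorem finrank_inf (Z : Submodule E (V × V)) :
    Module.finrank E ↥(Z ⊓ LinearMap.range (LinearMap.inl E V V)) =
      Module.finrank E (Z.comap (LinearMap.inl E V V)) := by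
  rw [inf_comm, ← Submodule.map_comap_eq]
  exact (Submodule.equivMapOfInjective _ LinearMap.inl_injective _).finrank_eq.symm

theorem exists_lift (Z : Submodule E (V × V)) :
    ∃ S : V →ₗ[E] V, ∀ w ∈ Z.map (LinearMap.fst E V V), (w, S w) ∈ Z := by
  obtain ⟨s, hs⟩ := LinearMap.exists_rightInverse_of_surjective
    ((LinearMap.fst E V V).comp Z.subtype).rangeRestrict (LinearMap.range_rangeRestrict _)
  obtain ⟨S, hS⟩ := LinearMap.exists_extend (((LinearMap.snd E V V).comp Z.subtype).comp s)
  refine ⟨S, fun w hw => ?_⟩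
  have hw' : w ∈ LinearMap.range ((LinearMap.fst E V V).comp Z.subtype) := by
    rwa [LinearMap.range_comp, Submodule.range_subtype]
  have e1 := congrArg Subtype.val (LinearMap.congr_fun hs ⟨w, hw'⟩)
  have e2 := LinearMap.congr_fun hS ⟨w, hw'⟩
  have e3 : (w, S w) = (s ⟨w, hw'⟩ : V × V) := Prod.ext e1.symm e2
  rw [e3]
  exact (s _).2

theorem backward [FiniteDimensional E V] (h : EHForm σ ε φ) (h2 : (2 : E) ≠ 0)
    {Z Z' : Submodule E (V × V)}
    (hZ : Iso (dbl φ) Z) (hmax : ∀ Z₁, Iso (dbl φ) Z₁ → Z ≤ Z₁ → Z₁ = Z)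
    (hZ' : Iso (dbl φ) Z') (hmax' : ∀ Z₁, Iso (dbl φ) Z₁ → Z' ≤ Z₁ → Z₁ = Z')
    (hdim : Module.finrank E (Z.comap (LinearMap.inl E V V)) =
      Module.finrank E (Z'.comap (LinearMap.inl E V V))) :
    ∃ g g' : V ≃ₗ[E] V,
      (∀ u v, φ (g u) (g v) = φ u v) ∧ (∀ u v, φ (g' u) (g' v) = φ u v) ∧
      Z' = Submodule.map ((g : V →ₗ[E] V).prodMap (g' : V →ₗ[E] V)) Z := by
  have hZZ := h.lagr_double hZ hmax
  have hZZ' := h.lagr_double hZ' hmax'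
  have hdimB : Module.finrank E (Z.comap (LinearMap.inr E V V)) =
      Module.finrank E (Z'.comap (LinearMap.inr E V V)) := by
    rw [h.rank_AB hZ hZZ, h.rank_AB hZ' hZZ', hdim]
  have hP := h.map_fst_eq hZ hZZ
  have hP' := h.map_fst_eq hZ' hZZ'
  set A := Z.comap (LinearMap.inl E V V) with hA
  set A' := Z'.comap (LinearMap.inl E V V) with hA'
  set B := Z.comap (LinearMap.inr E V V) with hB
  set B' := Z'.comap (LinearMap.inr E V V) with hB'
  have mA : ∀ w, w ∈ A ↔ (w, (0 : V)) ∈ Z := fun w => Iff.rfl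
  have mA' : ∀ w, w ∈ A' ↔ (w, (0 : V)) ∈ Z' := fun w => Iff.rfl
  have mB : ∀ w, w ∈ B ↔ ((0 : V), w) ∈ Z := fun w => Iff.rfl
  have mB' : ∀ w, w ∈ B' ↔ ((0 : V), w) ∈ Z' := fun w => Iff.rfl
  have iA : ∀ x ∈ A, ∀ y ∈ A, φ x y = 0 := fun x hx y hy => by
    simpa [dbl, h.zr] using hZ _ hx _ hy
  have iA' : ∀ x ∈ A', ∀ y ∈ A', φ x y = 0 := fun x hx y hy => by
    simpa [dbl, h.zr] using hZ' _ hx _ hy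
  have iB : ∀ x ∈ B, ∀ y ∈ B, φ x y = 0 := fun x hx y hy => by
    simpa [dbl, h.zr] using hZ _ hx _ hy
  have iB' : ∀ x ∈ B', ∀ y ∈ B', φ x y = 0 := fun x hx y hy => by
    simpa [dbl, h.zr] using hZ' _ hx _ hy
  let α : A ≃ₗ[E] A' := LinearEquiv.ofFinrankEq _ _ hdim
  let β : B ≃ₗ[E] B' := LinearEquiv.ofFinrankEq _ _ hdimB
  -- the first isometry
  obtain ⟨g, hg, hgα⟩ := h.witt h2
    (G₀ := LinearMap.range (A.subtype.prod (A'.subtype.comp α.toLinearMap)))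
    (by
      rintro _ ⟨a, rfl⟩ _ ⟨b, rfl⟩
      simp [dbl, iA a a.2 b b.2, iA' _ (α a).2 _ (α b).2])
    (by
      rintro w ⟨a, ha⟩
      have e1 : (a : V) = w := congrArg Prod.fst ha
      have e2 : (α a : V) = 0 := congrArg Prod.snd ha
      have : a = 0 := by simpa using e2
      rw [← e1, this]; rfl)
    (by
      rintro w ⟨a, ha⟩
      have e1 : (a : V) = 0 := congrArg Prod.fst ha
      have e2 : (α a : V) = w := congrArg Prod.snd ha
      have : a = 0 := by simpa using e1
      rw [← e2, this]; simp)
  have hgA : ∀ a ∈ A, g a ∈ A' := fun a ha => by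
    have := hgα _ ⟨⟨a, ha⟩, rfl⟩
    have e : g a = α ⟨a, ha⟩ := this
    rw [e]; exact (α _).2
  have hgA' : ∀ w, g w ∈ A' → w ∈ A := fun w hw => by
    have e : g (α.symm ⟨g w, hw⟩) = α (α.symm ⟨g w, hw⟩) := hgα _ ⟨α.symm ⟨g w, hw⟩, rfl⟩
    rw [α.apply_symm_apply] at e
    have := g.injective e
    rw [← this]; exact (α.symm _).2
  have hgP : ∀ w ∈ h.perp A, g w ∈ Z'.map (LinearMap.fst E V V) := fun w hw => by
    rw [hP']
    intro u hu
    obtain ⟨x, rfl⟩ := g.surjective u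
    rw [hg]
    exact hw x (hgA' x hu)
  have hAP : A ≤ h.perp A := fun a ha u hu => iA u hu a ha
  -- a complement of A in its perp
  obtain ⟨C₀, hC₀⟩ := Submodule.exists_isCompl A
  set C := C₀ ⊓ h.perp A with hC
  have hCA : ∀ c ∈ C, c ∈ A → c = 0 := fun c hc hca =>
    (Submodule.disjoint_def.1 hC₀.disjoint) c hca hc.1
  have hdec : ∀ w ∈ h.perp A, ∃ a ∈ A, ∃ c ∈ C, w = a + c := fun w hw => by
    have : w ∈ A ⊔ C₀ := by rw [hC₀.sup_eq_top]; trivial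
    obtain ⟨a, ha, c, hc, rfl⟩ := Submodule.mem_sup.1 this
    refine ⟨a, ha, c, ⟨hc, ?_⟩, rfl⟩
    simpa using (h.perp A).sub_mem hw (hAP ha)
  obtain ⟨T, hT⟩ := exists_lift Z
  obtain ⟨T', hT'⟩ := exists_lift Z'
  have hTC : ∀ c ∈ C, (c, T c) ∈ Z := fun c hc => hT c (by rw [hP]; exact hc.2)
  have hTC' : ∀ c ∈ C, (g c, T' (g c)) ∈ Z' := fun c hc => hT' _ (hgP c hc.2)
  -- the second isometry
  let G₁ : Submodule E (V × V) := LinearMap.range (B.subtype.prod (B'.subtype.comp β.toLinearMap))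
  let G₂ : Submodule E (V × V) := C.map (T.prod (T'.comp g.toLinearMap))
  have hG : ∀ p ∈ G₁ ⊔ G₂, ∃ b : B, ∃ c ∈ C, p = (b + T c, β b + T' (g c)) := by
    intro p hp
    obtain ⟨_, ⟨b, rfl⟩, _, ⟨c, hc, rfl⟩, rfl⟩ := Submodule.mem_sup.1 hp
    exact ⟨b, c, hc, rfl⟩
  obtain ⟨g', hg', hgβ⟩ := h.witt h2 (G₀ := G₁ ⊔ G₂)
    (by
      refine h.double.iso_sup ?_ ?_ ?_
      · rintro _ ⟨a, rfl⟩ _ ⟨b, rfl⟩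
        simp [dbl, iB a a.2 b b.2, iB' _ (β a).2 _ (β b).2]
      · rintro _ ⟨c, hc, rfl⟩ _ ⟨d, hd, rfl⟩
        have e1 := hZ _ (hTC c hc) _ (hTC d hd)
        have e2 := hZ' _ (hTC' c hc) _ (hTC' d hd)
        simp only [dbl, hg] at e1 e2
        change φ (T c) (T d) - φ (T' (g c)) (T' (g d)) = 0
        linear_combination e2 - e1
      · rintro _ ⟨b, rfl⟩ _ ⟨d, hd, rfl⟩
        have e1 := hZ _ b.2 _ (hTC d hd)
        have e2 := hZ' _ (β b).2 _ (hTC' d hd)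
        simp only [dbl, LinearMap.inr_apply, h.zl] at e1 e2
        change φ b (T d) - φ (β b) (T' (g d)) = 0
        linear_combination e2 - e1)
    (by
      intro w hw
      obtain ⟨b, c, hc, he⟩ := hG _ hw
      have e1 : w = b + T c := congrArg Prod.fst he
      have e2 : 0 = (β b : V) + T' (g c) := congrArg Prod.snd he
      have m := Z'.add_mem (hTC' c hc) (β b).2
      simp only [LinearMap.inr_apply, Prod.mk_add_mk, add_zero] at m
      rw [add_comm (T' (g c)), ← e2] at m
      have c0 := hCA c hc (hgA' c m)
      subst c0
      have : b = 0 := by simpa using e2.symm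
      rw [e1, this]; simp)
    (by
      intro w hw
      obtain ⟨b, c, hc, he⟩ := hG _ hw
      have e1 : 0 = (b : V) + T c := congrArg Prod.fst he
      have e2 : w = (β b : V) + T' (g c) := congrArg Prod.snd he
      have m := Z.add_mem (hTC c hc) b.2
      simp only [LinearMap.inr_apply, Prod.mk_add_mk, add_zero] at m
      rw [add_comm (T c), ← e1] at m
      have c0 := hCA c hc m
      subst c0
      have : b = 0 := by simpa using e1.symm
      rw [e2, this]; simp)
  have hgB : ∀ b : B, g' b = β b := fun b =>
    hgβ _ (Submodule.mem_sup_left ⟨b, rfl⟩)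
  have hgT : ∀ c ∈ C, g' (T c) = T' (g c) := fun c hc =>
    hgβ _ (Submodule.mem_sup_right ⟨c, hc, rfl⟩)
  refine ⟨g, g', hg, hg', ?_⟩
  have hle : Z ≤ Z'.comap ((g : V →ₗ[E] V).prodMap (g' : V →ₗ[E] V)) := by
    rintro ⟨w, w'⟩ hw
    have hwP : w ∈ h.perp A := by rw [← hP]; exact ⟨_, hw, rfl⟩
    obtain ⟨a, ha, c, hc, rfl⟩ := hdec w hwP
    have hb : w' - T c ∈ B := by
      have := Z.sub_mem (Z.sub_mem hw ha) (hTC c hc)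
      simpa [mB] using this
    have e := hgB ⟨_, hb⟩
    have m := Z'.add_mem (Z'.add_mem (hgA a ha) (hTC' c hc)) (β ⟨_, hb⟩).2
    rw [← e, ← hgT c hc] at m
    simpa using m
  have hiso : Iso (dbl φ) (Z'.comap ((g : V →ₗ[E] V).prodMap (g' : V →ₗ[E] V))) := by
    intro x hx y hy
    have := hZ' _ hx _ hy
    simpa [dbl, hg, hg'] using this
  have heq := hmax _ hiso hle
  rw [← heq, Submodule.map_comap_eq_of_surjective]
  rintro ⟨x, y⟩
  exact ⟨(g.symm x, g'.symm y), by simp⟩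

theorem forward {Z : Submodule E (V × V)} (g g' : V ≃ₗ[E] V) :
    Module.finrank E (Z.comap (LinearMap.inl E V V)) =
      Module.finrank E ((Z.map ((g : V →ₗ[E] V).prodMap (g' : V →ₗ[E] V))).comap
        (LinearMap.inl E V V)) := by
  have : (Z.map ((g : V →ₗ[E] V).prodMap (g' : V →ₗ[E] V))).comap (LinearMap.inl E V V) =
      (Z.comap (LinearMap.inl E V V)).map (g : V →ₗ[E] V) := by
    ext w
    constructor
    · rintro ⟨⟨x, y⟩, hx, he⟩
      have e1 : g x = w := congrArg Prod.fst he
      have e2 : g' y = 0 := congrArg Prod.snd he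
      obtain rfl : y = 0 := by simpa using e2
      exact ⟨x, hx, e1⟩
    · rintro ⟨x, hx, rfl⟩
      exact ⟨(x, 0), hx, by simp⟩
  rw [this]
  exact (LinearEquiv.finrank_map_eq g _).symm

end EHForm
end DoublingHelpers

/-- Doubling orbit classification: let `(W,φ)` be a nondegenerate ε-hermitian space over
a field `E` with involution, char ≠ 2, and `2W = W ⊕ (-W)` with form
`Φ = φ ⊖ φ`.  Two maximal totally isotropic subspaces `Z, Z'` of `2W` lie in the same
orbit of `U(W) × U(-W)` (acting componentwise) if and only if
`dim(Z ∩ (W⊕0)) = dim(Z' ∩ (W⊕0))`. -/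
theorem doubling_orbit_classification {E W : Type*} [Field E] [AddCommGroup W]
    [Module E W] [FiniteDimensional E W]
    (σ : E →+* E) (hσ : ∀ a, σ (σ a) = a)
    (ε : E) (hε : ε = 1 ∨ ε = -1) (h2 : (2 : E) ≠ 0)
    (φ : W → W → E)
    (haddl : ∀ w w' v, φ (w + w') v = φ w v + φ w' v)
    (haddr : ∀ w v v', φ w (v + v') = φ w v + φ w v')
    (hsmull : ∀ (a : E) w v, φ (a • w) v = a * φ w v)
    (hsmulr : ∀ (a : E) w v, φ w (a • v) = σ a * φ w v)
    (hherm : ∀ w v, φ v w = ε * σ (φ w v))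
    (hnd : ∀ w, (∀ v, φ w v = 0) → w = 0) :
    ∀ (Φ : W × W → W × W → E), (Φ = fun p q => φ p.1 q.1 - φ p.2 q.2) →
    ∀ Iso : Submodule E (W × W) → Prop,
      (Iso = fun Z => ∀ x ∈ Z, ∀ y ∈ Z, Φ x y = 0) →
    ∀ Z Z' : Submodule E (W × W),
      Iso Z → (∀ Z₁, Iso Z₁ → Z ≤ Z₁ → Z₁ = Z) →
      Iso Z' → (∀ Z₁, Iso Z₁ → Z' ≤ Z₁ → Z₁ = Z') →
      ((∃ g g' : W ≃ₗ[E] W,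
          (∀ u v, φ (g u) (g v) = φ u v) ∧ (∀ u v, φ (g' u) (g' v) = φ u v) ∧
          Z' = Submodule.map ((g : W →ₗ[E] W).prodMap (g' : W →ₗ[E] W)) Z)
        ↔ Module.finrank E ↥(Z ⊓ LinearMap.range (LinearMap.inl E W W))
            = Module.finrank E ↥(Z' ⊓ LinearMap.range (LinearMap.inl E W W))) := by
  intro Φ hΦ Iso hIso Z Z' hZ hmax hZ' hmax'
  subst hΦ
  subst hIso
  have h : EHForm σ ε φ := ⟨hσ, hε, haddl, haddr, hsmull, hsmulr, hherm, hnd⟩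
  rw [EHForm.finrank_inf, EHForm.finrank_inf]
  constructor
  · rintro ⟨g, g', -, -, rfl⟩
    exact EHForm.forward g g'
  · exact h.backward h2 hZ hmax hZ' hmax'
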